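/- Let v, w ∈ C⁴(ℝ) be positive solutions of the ODE v'''' − A·v'' − f(v) = 0 on ℝ with lim_{|t|→∞} v(t) = 0, lim_{|t|→∞} w(t) = 0 and v'(0) = w'(0) = 0. Then v(t) = w(t) for all t ∈ ℝ. -/

import Mathlib

open Real Filter

namespace Paper

/-- The coefficient `A = (n(n-4)+8)/2`. -/
noncomputable def A (n : ℕ) : ℝ := ((n : ℝ) * ((n : ℝ) - 4) + 8) / 2

/-- The coefficient `B = n²(n-4)²/16`. -/
noncomputable def B (n : ℕ) : ℝ := (n : ℝ) ^ 2 * ((n : ℝ) - 4) ^ 2 / 16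

/-- The exponent `p = (n+4)/(n-4)`. -/
noncomputable def p (n : ℕ) : ℝ := ((n : ℝ) + 4) / ((n : ℝ) - 4)

/-- The nonlinearity `f(v) = |v|^(p-1) v - B v`. -/
noncomputable def f (n : ℕ) (v : ℝ) : ℝ := |v| ^ (p n - 1) * v - B n * v

/-- The constant `a₀ = (n(n-4)/4)^((n-4)/4)`. -/
noncomputable def a₀ (n : ℕ) : ℝ := ((n : ℝ) * ((n : ℝ) - 4) / 4) ^ (((n : ℝ) - 4) / 4)

/-- The constant `c_n = ((n-4)(n-2)n(n+2))^((n-4)/8)`. -/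
noncomputable def c (n : ℕ) : ℝ :=
  (((n : ℝ) - 4) * ((n : ℝ) - 2) * (n : ℝ) * ((n : ℝ) + 2)) ^ (((n : ℝ) - 4) / 8)

/-- The potential `F(v) = |v|^(p+1)/(p+1) - (B/2) v²`. -/
noncomputable def F (n : ℕ) (s : ℝ) : ℝ := |s| ^ (p n + 1) / (p n + 1) - B n / 2 * s ^ 2

/-- The energy `E_v(t) = -v''' v' + v''²/2 + (A/2) v'² + F(v)`. -/
noncomputable def E (n : ℕ) (v : ℝ → ℝ) (t : ℝ) : ℝ :=
  -(iteratedDeriv 3 v t) * deriv v t + 1 / 2 * (iteratedDeriv 2 v t) ^ 2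
    + A n / 2 * (deriv v t) ^ 2 + F n (v t)

end Paper

/-! ### Calculus on half-lines -/

section Calculus

variable {f f' f'' : ℝ → ℝ}

theorem le_of_hasDerivAt_nonneg (hf : ∀ t, HasDerivAt f (f' t) t) {s t : ℝ} (hst : s ≤ t)
    (h : ∀ x ∈ Set.Ioo s t, 0 ≤ f' x) : f s ≤ f t := by
  have hm : MonotoneOn f (Set.Icc s t) := by
    apply monotoneOn_of_deriv_nonneg (convex_Icc s t)
    · exact fun x _ => (hf x).continuousAt.continuousWithinAt
    · exact fun x _ => (hf x).differentiableAt.differentiableWithinAt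
    · intro x hx
      rw [interior_Icc] at hx
      rw [(hf x).deriv]
      exact h x hx
  exact hm (Set.left_mem_Icc.2 hst) (Set.right_mem_Icc.2 hst) hst

/-- Integrating-factor comparison for a linear first-order differential inequality. -/
theorem exp_mul_le_of_hasDerivAt (hf : ∀ t, HasDerivAt f (f' t) t) {c T : ℝ} (hT : 0 ≤ T)
    (h : ∀ x ∈ Set.Ioo 0 T, c * f x ≤ f' x) : exp (c * T) * f 0 ≤ f T := by
  have hd : ∀ t, HasDerivAt (fun t => exp (-(c * t)) * f t)
      (exp (-(c * t)) * (f' t - c * f t)) t := by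
    intro t
    have h1 : HasDerivAt (fun t : ℝ => -(c * t)) (-(c * 1)) t :=
      ((hasDerivAt_id t).const_mul c).neg
    refine (h1.exp.mul (hf t)).congr_deriv ?_
    ring
  have key := le_of_hasDerivAt_nonneg hd hT fun x hx =>
    mul_nonneg (exp_pos _).le (sub_nonneg.2 (h x hx))
  simp only [mul_zero, neg_zero, exp_zero, one_mul] at key
  calc exp (c * T) * f 0 ≤ exp (c * T) * (exp (-(c * T)) * f T) := by gcongr
    _ = f T := by rw [← mul_assoc, ← exp_add]; simp

theorem eventually_pos_of_hasDerivAt (hf : ∀ t, HasDerivAt f (f' t) t) (h0 : f 0 = 0)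
    (h : ∀ᶠ t in nhdsWithin 0 (Set.Ioi 0), 0 < f' t) :
    ∀ᶠ t in nhdsWithin 0 (Set.Ioi 0), 0 < f t := by
  obtain ⟨δ, hδ, hpos⟩ := mem_nhdsGT_iff_exists_Ioo_subset.1 h
  refine mem_nhdsGT_iff_exists_Ioo_subset.2 ⟨δ, hδ, fun t ht => ?_⟩
  have hm : StrictMonoOn f (Set.Icc 0 t) := by
    apply strictMonoOn_of_deriv_pos (convex_Icc 0 t)
    · exact fun x _ => (hf x).continuousAt.continuousWithinAt
    · intro x hx
      rw [interior_Icc] at hx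
      rw [(hf x).deriv]
      exact hpos ⟨hx.1, hx.2.trans ht.2⟩
  have := hm (Set.left_mem_Icc.2 ht.1.le) (Set.right_mem_Icc.2 ht.1.le) ht.1
  simpa [h0] using this

theorem eventually_nhdsGT_pos (hf : ContinuousAt f 0) (h0 : 0 < f 0) :
    ∀ᶠ t in nhdsWithin 0 (Set.Ioi 0), 0 < f t :=
  (hf.eventually (lt_mem_nhds h0)).filter_mono nhdsWithin_le_nhds

/-- A function whose second derivative is eventually bounded below by a positive constant does
not have a finite limit. -/
theorem not_tendsto_of_second_deriv_ge (hf : ∀ t, HasDerivAt f (f' t) t)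
    (hf' : ∀ t, HasDerivAt f' (f'' t) t) {δ : ℝ} (hδ : 0 < δ) (h : ∀ᶠ t in atTop, δ ≤ f'' t)
    (l : ℝ) : ¬ Tendsto f atTop (nhds l) := by
  intro hl
  obtain ⟨T, hT⟩ := eventually_atTop.1 h
  have h1 : ∀ t, T ≤ t → f' T + δ * (t - T) ≤ f' t := by
    intro t ht
    have hd : ∀ x, HasDerivAt (fun x => f' x - δ * x) (f'' x - δ * 1) x := fun x =>
      (hf' x).sub ((hasDerivAt_id x).const_mul δ)
    have := le_of_hasDerivAt_nonneg hd ht fun x hx => by linarith [hT x hx.1.le]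
    linarith
  obtain ⟨S, hTS, hS⟩ : ∃ S, T ≤ S ∧ ∀ t, S ≤ t → 1 ≤ f' t := by
    refine ⟨T + |1 - f' T| / δ, by linarith [div_nonneg (abs_nonneg (1 - f' T)) hδ.le],
      fun t ht => ?_⟩
    have h2 : |1 - f' T| / δ ≤ t - T := by linarith
    have h3 := (div_le_iff₀ hδ).1 h2
    have h4 := h1 t (by linarith [div_nonneg (abs_nonneg (1 - f' T)) hδ.le])
    linarith [le_abs_self (1 - f' T)]
  have h5 : ∀ t, S ≤ t → f S + (t - S) ≤ f t := by
    intro t ht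
    have hd : ∀ x, HasDerivAt (fun x => f x - x) (f' x - 1) x := fun x =>
      (hf x).sub (hasDerivAt_id x)
    have := le_of_hasDerivAt_nonneg hd ht fun x hx => by linarith [hS x hx.1.le]
    linarith
  have h6 : Tendsto f atTop atTop := by
    refine tendsto_atTop_mono' _ (f₁ := fun t => (f S - S) + t) ?_
      (tendsto_atTop_add_const_left _ _ tendsto_id)
    filter_upwards [eventually_ge_atTop S] with t ht
    linarith [h5 t ht]
  exact not_tendsto_nhds_of_tendsto_atTop h6 l hl

theorem abs_deriv_le_interpolation (hf : ∀ t, HasDerivAt f (f' t) t)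
    (hf' : ∀ t, HasDerivAt f' (f'' t) t) {C : ℝ} (hC : ∀ t, |f'' t| ≤ C) {h : ℝ} (hh : 0 < h)
    (t : ℝ) : |f' t| ≤ |f (t + h) - f t| / h + C * h := by
  obtain ⟨x, hx, hxe⟩ := exists_hasDerivAt_eq_slope f f' (a := t) (b := t + h) (by linarith)
    (fun x _ => (hf x).continuousAt.continuousWithinAt) (fun x _ => hf x)
  obtain ⟨y, -, hye⟩ := exists_hasDerivAt_eq_slope f' f'' (a := t) (b := x) hx.1
    (fun x _ => (hf' x).continuousAt.continuousWithinAt) (fun x _ => hf' x)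
  have hxt : 0 < x - t := by linarith [hx.1]
  have e1 : f' x - f' t = f'' y * (x - t) := by rw [hye]; field_simp
  have e2 : |f' x| = |f (t + h) - f t| / h := by
    rw [hxe, add_sub_cancel_left, abs_div, abs_of_pos hh]
  have e3 : |f' x - f' t| ≤ C * h := by
    rw [e1, abs_mul, abs_of_pos hxt]
    exact mul_le_mul (hC y) (by linarith [hx.2]) hxt.le ((abs_nonneg _).trans (hC y))
  have e4 : |f' t| ≤ |f' x| + |f' x - f' t| := by
    have := abs_sub_abs_le_abs_sub (f' t) (f' x)
    rw [abs_sub_comm] at this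
    linarith
  linarith

theorem exists_deriv_bound (hf : ∀ t, HasDerivAt f (f' t) t)
    (hf' : ∀ t, HasDerivAt f' (f'' t) t) (hb : ∃ M, ∀ t, |f t| ≤ M)
    (hb'' : ∃ C, ∀ t, |f'' t| ≤ C) : ∃ D, ∀ t, |f' t| ≤ D := by
  obtain ⟨M, hM⟩ := hb
  obtain ⟨C, hC⟩ := hb''
  refine ⟨2 * M + C, fun t => ?_⟩
  have h1 := abs_deriv_le_interpolation hf hf' hC one_pos t
  have h2 := abs_sub (f (t + 1)) (f t)
  have h3 := hM (t + 1)
  have h4 := hM t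
  simp only [div_one, mul_one] at h1
  linarith

theorem tendsto_deriv_zero (hf : ∀ t, HasDerivAt f (f' t) t)
    (hf' : ∀ t, HasDerivAt f' (f'' t) t) (hlim : Tendsto f atTop (nhds 0))
    (hb'' : ∃ C, ∀ t, |f'' t| ≤ C) : Tendsto f' atTop (nhds 0) := by
  obtain ⟨C, hC⟩ := hb''
  have hC0 : 0 ≤ C := (abs_nonneg _).trans (hC 0)
  rw [Metric.tendsto_nhds]
  intro ε hε
  set h : ℝ := ε / (2 * (C + 1)) with hh
  have hpos : 0 < h := by positivity
  have hCh : C * h < ε / 2 + 0 := by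
    have : (C + 1) * h = ε / 2 := by rw [hh]; field_simp
    linarith
  have h1 : Tendsto (fun t => |f (t + h) - f t| / h) atTop (nhds 0) := by
    have := (((hlim.comp (tendsto_atTop_add_const_right _ h tendsto_id)).sub hlim).abs).div_const h
    simpa using this
  filter_upwards [h1.eventually (gt_mem_nhds (half_pos hε))] with t ht
  rw [Real.dist_eq, sub_zero]
  linarith [abs_deriv_le_interpolation hf hf' hC hpos t]

end Calculus

/-! ### The factored linear equation -/

/-- The equation `(∂² - b²)(∂² - a²) u = r` as a first-order system, with `u₁ = u'`,
`φ = u'' - a² u` and `φ₁ = φ'`. -/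
structure FactoredSystem (a b : ℝ) (u u₁ φ φ₁ r : ℝ → ℝ) : Prop where
  hasDerivAt_u : ∀ t, HasDerivAt u (u₁ t) t
  hasDerivAt_u₁ : ∀ t, HasDerivAt u₁ (φ t + a ^ 2 * u t) t
  hasDerivAt_φ : ∀ t, HasDerivAt φ (φ₁ t) t
  hasDerivAt_φ₁ : ∀ t, HasDerivAt φ₁ (b ^ 2 * φ t + r t) t

namespace FactoredSystem

variable {a b : ℝ} {u u₁ φ φ₁ r w w₁ ψ ψ₁ q : ℝ → ℝ}

theorem shift (h : FactoredSystem a b u u₁ φ φ₁ r) (s : ℝ) :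
    FactoredSystem a b (fun t => u (t + s)) (fun t => u₁ (t + s)) (fun t => φ (t + s))
      (fun t => φ₁ (t + s)) (fun t => r (t + s)) where
  hasDerivAt_u t := (h.hasDerivAt_u _).comp_add_const t s
  hasDerivAt_u₁ t := (h.hasDerivAt_u₁ _).comp_add_const t s
  hasDerivAt_φ t := (h.hasDerivAt_φ _).comp_add_const t s
  hasDerivAt_φ₁ t := (h.hasDerivAt_φ₁ _).comp_add_const t s

theorem reflect (h : FactoredSystem a b u u₁ φ φ₁ r) :
    FactoredSystem a b (fun t => u (-t)) (fun t => -u₁ (-t)) (fun t => φ (-t))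
      (fun t => -φ₁ (-t)) (fun t => r (-t)) := by
  have key : ∀ {g g' : ℝ → ℝ}, (∀ t, HasDerivAt g (g' t) t) →
      ∀ t, HasDerivAt (fun t => g (-t)) (-g' (-t)) t := fun hg t =>
    ((hg (-t)).comp t (hasDerivAt_neg t)).congr_deriv (by ring)
  refine ⟨key h.hasDerivAt_u, fun t => ?_, key h.hasDerivAt_φ, fun t => ?_⟩
  · simpa only [neg_neg] using (key h.hasDerivAt_u₁ t).fun_neg
  · simpa only [neg_neg] using (key h.hasDerivAt_φ₁ t).fun_neg

theorem sub_smul (h : FactoredSystem a b u u₁ φ φ₁ r) (h' : FactoredSystem a b w w₁ ψ ψ₁ q)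
    (κ : ℝ) :
    FactoredSystem a b (fun t => u t - κ * w t) (fun t => u₁ t - κ * w₁ t)
      (fun t => φ t - κ * ψ t) (fun t => φ₁ t - κ * ψ₁ t) (fun t => r t - κ * q t) where
  hasDerivAt_u t := (h.hasDerivAt_u t).sub ((h'.hasDerivAt_u t).const_mul κ)
  hasDerivAt_u₁ t := ((h.hasDerivAt_u₁ t).sub ((h'.hasDerivAt_u₁ t).const_mul κ)).congr_deriv
    (by ring)
  hasDerivAt_φ t := (h.hasDerivAt_φ t).sub ((h'.hasDerivAt_φ t).const_mul κ)
  hasDerivAt_φ₁ t := ((h.hasDerivAt_φ₁ t).sub ((h'.hasDerivAt_φ₁ t).const_mul κ)).congr_deriv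
    (by ring)

end FactoredSystem

/-- Solutions of `φ'' ≥ b² φ` with nonnegative Cauchy data at `0` are nondecreasing to the right
of `0`. -/
theorem le_of_second_deriv_ge {b T : ℝ} {φ φ₁ r : ℝ → ℝ}
    (hφ : ∀ t, HasDerivAt φ (φ₁ t) t) (hφ₁ : ∀ t, HasDerivAt φ₁ (b ^ 2 * φ t + r t) t)
    (hr : ∀ t ∈ Set.Ioo 0 T, 0 ≤ r t) (h0 : 0 ≤ φ 0) (h1 : 0 ≤ φ₁ 0) (hb : 0 ≤ b)
    (hT : 0 ≤ T) : φ 0 ≤ φ T := by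
  have hy : ∀ t, HasDerivAt (fun t => φ₁ t + b * φ t) (b ^ 2 * φ t + r t + b * φ₁ t) t :=
    fun t => (hφ₁ t).add ((hφ t).const_mul b)
  have hy0 : ∀ t ∈ Set.Icc 0 T, 0 ≤ φ₁ t + b * φ t := fun t ht => by
    refine le_trans ?_ (exp_mul_le_of_hasDerivAt (c := b) hy ht.1 fun x hx => ?_)
    · positivity
    · nlinarith [hr x ⟨hx.1, hx.2.trans_le ht.2⟩]
  have hφ0 : ∀ t ∈ Set.Icc 0 T, 0 ≤ φ t := fun t ht => by
    refine le_trans ?_ (exp_mul_le_of_hasDerivAt (c := -b) hφ ht.1 fun x hx => ?_)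
    · positivity
    · linarith [hy0 x ⟨hx.1.le, hx.2.le.trans ht.2⟩]
  have hφ₁0 : ∀ t ∈ Set.Icc 0 T, 0 ≤ φ₁ t := fun t ht =>
    h1.trans <| le_of_hasDerivAt_nonneg hφ₁ ht.1 fun x hx => by
      have := hφ0 x ⟨hx.1.le, hx.2.le.trans ht.2⟩
      have := hr x ⟨hx.1, hx.2.trans_le ht.2⟩
      positivity
  exact le_of_hasDerivAt_nonneg hφ hT fun x hx => hφ₁0 x ⟨hx.1.le, hx.2.le⟩

namespace FactoredSystem

variable {a b : ℝ} {u u₁ φ φ₁ r : ℝ → ℝ}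

theorem le_of_nonneg {T : ℝ} (h : FactoredSystem a b u u₁ φ φ₁ r) (hb : 0 ≤ b)
    (hr : ∀ t, 0 ≤ u t → 0 ≤ r t) (h1 : 0 ≤ u₁ 0) (h2 : 0 ≤ φ 0)
    (h3 : 0 ≤ φ₁ 0) (hu : ∀ t ∈ Set.Ioo 0 T, 0 ≤ u t) {s : ℝ} (hs : 0 ≤ s) (hsT : s ≤ T) :
    u s ≤ u T := by
  have hφ : ∀ t ∈ Set.Icc 0 T, 0 ≤ φ t := fun t ht =>
    h2.trans <| le_of_second_deriv_ge h.hasDerivAt_φ h.hasDerivAt_φ₁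
      (fun x hx => hr x (hu x ⟨hx.1, hx.2.trans_le ht.2⟩)) h2 h3 hb ht.1
  have hu₁ : ∀ t ∈ Set.Icc 0 T, 0 ≤ u₁ t := fun t ht =>
    h1.trans <| le_of_hasDerivAt_nonneg h.hasDerivAt_u₁ ht.1 fun x hx => by
      have := hφ x ⟨hx.1.le, hx.2.le.trans ht.2⟩
      have := hu x ⟨hx.1, hx.2.trans_le ht.2⟩
      positivity
  exact le_of_hasDerivAt_nonneg h.hasDerivAt_u hsT fun x hx =>
    hu₁ x ⟨hs.trans hx.1.le, hx.2.le⟩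

/-- If `u` becomes positive immediately to the right of `0` and the remaining Cauchy data are
nonnegative, then `u` does not decay at `+∞`. -/
theorem not_tendsto_zero (h : FactoredSystem a b u u₁ φ φ₁ r) (hb : 0 ≤ b)
    (hr : ∀ t, 0 ≤ u t → 0 ≤ r t) (h1 : 0 ≤ u₁ 0) (h2 : 0 ≤ φ 0)
    (h3 : 0 ≤ φ₁ 0) (hpos : ∀ᶠ t in nhdsWithin 0 (Set.Ioi 0), 0 < u t) :
    ¬ Tendsto u atTop (nhds 0) := by
  intro hlim
  obtain ⟨δ, hδ, hsub⟩ := mem_nhdsGT_iff_exists_Ioo_subset.1 hpos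
  have hδ' : (0 : ℝ) < δ := hδ
  have hmid : 0 < u (δ / 2) := hsub ⟨by linarith, by linarith⟩
  have hcont : Continuous u :=
    continuous_iff_continuousAt.2 fun t => (h.hasDerivAt_u t).continuousAt
  have hall : ∀ T, δ / 2 ≤ T → 0 < u T := by
    by_contra! hcon
    obtain ⟨T₀, hT₀, hT₀u⟩ := hcon
    let S : Set ℝ := Set.Ici (δ / 2) ∩ {t | u t ≤ 0}
    have hSne : S.Nonempty := ⟨T₀, hT₀, hT₀u⟩
    have hSbdd : BddBelow S := ⟨δ / 2, fun x hx => hx.1⟩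
    have hSclosed : IsClosed S := isClosed_Ici.inter (isClosed_le hcont continuous_const)
    have hmem := hSclosed.csInf_mem hSne hSbdd
    set T := sInf S with hT
    have hlt : ∀ t ∈ Set.Ioo 0 T, 0 ≤ u t := by
      intro t ht
      rcases lt_or_ge t (δ / 2) with h' | h'
      · exact (hsub ⟨ht.1, by linarith⟩ : 0 < u t).le
      · by_contra! hneg
        exact absurd (csInf_le hSbdd (⟨h', hneg.le⟩ : t ∈ S)) (not_le.2 ht.2)
    have := h.le_of_nonneg hb hr h1 h2 h3 hlt (half_pos hδ').le hmem.1
    have h5 : u T ≤ 0 := hmem.2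
    linarith
  have hnn : ∀ t, 0 < t → 0 ≤ u t := by
    intro t ht
    rcases lt_or_ge t (δ / 2) with h' | h'
    · exact (hsub ⟨ht, by linarith⟩ : 0 < u t).le
    · exact (hall t h').le
  have hge : ∀ᶠ t in atTop, u (δ / 2) ≤ u t := by
    filter_upwards [eventually_ge_atTop (δ / 2)] with t ht
    exact h.le_of_nonneg hb hr h1 h2 h3 (fun x hx => hnn x hx.1) (half_pos hδ').le ht
  exact absurd (ge_of_tendsto hlim hge) (not_le.2 hmid)

/-- No decaying `u` has Cauchy data `u = u' = 0`, `u'' > 0` at a point. -/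
theorem false_of_second_pos (h : FactoredSystem a b u u₁ φ φ₁ r) (hb : 0 ≤ b)
    (hr : ∀ t, 0 ≤ u t → 0 ≤ r t) (htop : Tendsto u atTop (nhds 0))
    (hbot : Tendsto u atBot (nhds 0)) (h0 : u 0 = 0) (h1 : u₁ 0 = 0) (h2 : 0 < φ 0) : False := by
  wlog h3 : 0 ≤ φ₁ 0 generalizing u u₁ φ φ₁ r
  · exact this h.reflect (fun t => hr (-t)) (hbot.comp tendsto_neg_atTop_atBot)
      (htop.comp tendsto_neg_atBot_atTop) (by simpa) (by simpa) (by simpa)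
      (by simp only [neg_zero]; linarith)
  refine h.not_tendsto_zero hb hr h1.ge h2.le h3 ?_ htop
  refine eventually_pos_of_hasDerivAt h.hasDerivAt_u h0
    (eventually_pos_of_hasDerivAt h.hasDerivAt_u₁ h1 (eventually_nhdsGT_pos ?_ ?_))
  · exact (h.hasDerivAt_φ 0).continuousAt.add ((h.hasDerivAt_u 0).continuousAt.const_mul _)
  · simpa [h0] using h2

/-- No decaying `u` has Cauchy data `u = u' = u'' = 0`, `u''' > 0` at a point. -/
theorem false_of_third_pos (h : FactoredSystem a b u u₁ φ φ₁ r) (hb : 0 ≤ b)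
    (hr : ∀ t, 0 ≤ u t → 0 ≤ r t) (htop : Tendsto u atTop (nhds 0))
    (h0 : u 0 = 0) (h1 : u₁ 0 = 0) (h2 : φ 0 = 0) (h3 : 0 < φ₁ 0) : False := by
  refine h.not_tendsto_zero hb hr h1.ge h2.ge h3.le ?_ htop
  refine eventually_pos_of_hasDerivAt h.hasDerivAt_u h0
    (eventually_pos_of_hasDerivAt h.hasDerivAt_u₁ h1
      (eventually_pos_of_hasDerivAt (f' := fun t => φ₁ t + a ^ 2 * u₁ t) (fun t => ?_) ?_
        (eventually_nhdsGT_pos ?_ ?_)))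
  · exact (h.hasDerivAt_φ t).add ((h.hasDerivAt_u t).const_mul _)
  · simp [h0, h2]
  · exact (h.hasDerivAt_φ₁ 0).continuousAt.add ((h.hasDerivAt_u₁ 0).continuousAt.const_mul _)
  · simpa [h1] using h3

/-- Unique continuation from vanishing Cauchy data. -/
theorem eq_zero (h : FactoredSystem a b u u₁ φ φ₁ r) {L : ℝ}
    (hr : ∀ t, |r t| ≤ L * |u t|) (h0 : u 0 = 0) (h1 : u₁ 0 = 0) (h2 : φ 0 = 0) (h3 : φ₁ 0 = 0)
    (t : ℝ) : u t = 0 := by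
  wlog ht : 0 ≤ t generalizing u u₁ φ φ₁ r t
  · simpa using this h.reflect (fun t => hr (-t)) (by simpa) (by simpa) (by simpa) (by simpa) (-t)
      (by linarith)
  let N : ℝ → ℝ := fun t => -(u t ^ 2 + u₁ t ^ 2 + φ t ^ 2 + φ₁ t ^ 2)
  have hN : ∀ t, HasDerivAt N (-(2 * u t * u₁ t + 2 * u₁ t * (φ t + a ^ 2 * u t)
      + 2 * φ t * φ₁ t + 2 * φ₁ t * (b ^ 2 * φ t + r t))) t := by
    intro t
    refine (((((h.hasDerivAt_u t).pow 2).add ((h.hasDerivAt_u₁ t).pow 2)).add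
      ((h.hasDerivAt_φ t).pow 2)).add ((h.hasDerivAt_φ₁ t).pow 2)).neg.congr_deriv ?_
    simp
  have key := exp_mul_le_of_hasDerivAt (c := 3 + a ^ 2 + b ^ 2 + L ^ 2) hN ht fun x _ => by
    have hr2 : r x ^ 2 ≤ L ^ 2 * u x ^ 2 := by
      have := pow_le_pow_left₀ (abs_nonneg _) (hr x) 2
      rwa [mul_pow, sq_abs, sq_abs] at this
    have e1 := sq_nonneg (u x - u₁ x)
    have e2 := sq_nonneg (u₁ x - φ x)
    have e3 := mul_nonneg (sq_nonneg a) (sq_nonneg (u x - u₁ x))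
    have e4 := sq_nonneg (φ x - φ₁ x)
    have e5 := mul_nonneg (sq_nonneg b) (sq_nonneg (φ x - φ₁ x))
    have e6 := sq_nonneg (φ₁ x - r x)
    have g1 := mul_nonneg (sq_nonneg a) (add_nonneg (sq_nonneg (φ x)) (sq_nonneg (φ₁ x)))
    have g2 := mul_nonneg (sq_nonneg b) (add_nonneg (sq_nonneg (u x)) (sq_nonneg (u₁ x)))
    have g3 := mul_nonneg (sq_nonneg L) (add_nonneg (sq_nonneg (u₁ x))
      (add_nonneg (sq_nonneg (φ x)) (sq_nonneg (φ₁ x))))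
    simp only [N]
    nlinarith [sq_nonneg (u x), sq_nonneg (u₁ x), sq_nonneg (φ x), sq_nonneg (φ₁ x)]
  simp only [N, h0, h1, h2, h3] at key
  norm_num at key
  have : u t ^ 2 ≤ 0 := by
    nlinarith [sq_nonneg (u₁ t), sq_nonneg (φ t), sq_nonneg (φ₁ t)]
  exact pow_eq_zero_iff two_ne_zero |>.1 (le_antisymm this (sq_nonneg _))

end FactoredSystem

/-! ### Positive homoclinic solutions of the nonlinear equation -/

theorem abs_rpow_sub_rpow_le {p M x y : ℝ} (hp : 1 ≤ p) (hx : 0 ≤ x) (hxM : x ≤ M) (hy : 0 ≤ y)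
    (hyM : y ≤ M) : |x ^ p - y ^ p| ≤ p * M ^ (p - 1) * |x - y| := by
  have := Convex.norm_image_sub_le_of_norm_hasDerivWithin_le (f := fun z : ℝ => z ^ p)
    (f' := fun z => p * z ^ (p - 1)) (C := p * M ^ (p - 1)) (s := Set.Icc 0 M)
    (fun z _ => (hasDerivAt_rpow_const (Or.inr hp)).hasDerivWithinAt)
    (fun z hz => ?_) (convex_Icc 0 M) ⟨hy, hyM⟩ ⟨hx, hxM⟩
  · simpa [Real.norm_eq_abs] using this
  · have hz0 : 0 ≤ z ^ (p - 1) := rpow_nonneg hz.1 _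
    rw [Real.norm_eq_abs, abs_of_nonneg (by positivity)]
    have := rpow_le_rpow hz.1 hz.2 (by linarith : 0 ≤ p - 1)
    gcongr

/-- A positive solution of `(∂² - b²)(∂² - a²) v = v ^ p` decaying at `±∞`. -/
structure HomoclinicSolution (a b p : ℝ) (v v₁ φ φ₁ : ℝ → ℝ) : Prop extends
    FactoredSystem a b v v₁ φ φ₁ (fun t => v t ^ p) where
  pos : ∀ t, 0 < v t
  tendsto_atTop : Tendsto v atTop (nhds 0)
  tendsto_atBot : Tendsto v atBot (nhds 0)

namespace HomoclinicSolution

variable {a b p : ℝ} {v v₁ φ φ₁ w w₁ ψ ψ₁ : ℝ → ℝ}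

theorem shift (h : HomoclinicSolution a b p v v₁ φ φ₁) (s : ℝ) :
    HomoclinicSolution a b p (fun t => v (t + s)) (fun t => v₁ (t + s)) (fun t => φ (t + s))
      (fun t => φ₁ (t + s)) where
  toFactoredSystem := h.toFactoredSystem.shift s
  pos _ := h.pos _
  tendsto_atTop := h.tendsto_atTop.comp (tendsto_atTop_add_const_right _ s tendsto_id)
  tendsto_atBot := h.tendsto_atBot.comp (tendsto_atBot_add_const_right _ s tendsto_id)

theorem reflect (h : HomoclinicSolution a b p v v₁ φ φ₁) :
    HomoclinicSolution a b p (fun t => v (-t)) (fun t => -v₁ (-t)) (fun t => φ (-t))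
      (fun t => -φ₁ (-t)) where
  toFactoredSystem := h.toFactoredSystem.reflect
  pos _ := h.pos _
  tendsto_atTop := h.tendsto_atBot.comp tendsto_neg_atTop_atBot
  tendsto_atBot := h.tendsto_atTop.comp tendsto_neg_atBot_atTop

theorem exists_max (h : HomoclinicSolution a b p v v₁ φ φ₁) : ∃ T, ∀ t, v t ≤ v T := by
  have hcont : Continuous v :=
    continuous_iff_continuousAt.2 fun t => (h.hasDerivAt_u t).continuousAt
  refine hcont.exists_forall_ge' 0 ?_
  rw [cocompact_eq_atBot_atTop, eventually_sup]
  exact ⟨(h.tendsto_atBot.eventually (gt_mem_nhds (h.pos 0))).mono fun _ ht => le_of_lt ht,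
    (h.tendsto_atTop.eventually (gt_mem_nhds (h.pos 0))).mono fun _ ht => le_of_lt ht⟩

theorem φ_nonpos (h : HomoclinicSolution a b p v v₁ φ φ₁) (hb : 0 ≤ b) (s : ℝ) : φ s ≤ 0 := by
  wlog hs : s = 0 generalizing v v₁ φ φ₁ s
  · simpa using this (h.shift s) 0 rfl
  subst hs
  by_contra! hpos
  wlog h1 : 0 ≤ φ₁ 0 generalizing v v₁ φ φ₁
  · exact this h.reflect (by simpa) (by simp only [neg_zero]; linarith)
  refine not_tendsto_of_second_deriv_ge h.hasDerivAt_u h.hasDerivAt_u₁ hpos ?_ 0 h.tendsto_atTop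
  filter_upwards [eventually_ge_atTop 0] with t ht
  have := le_of_second_deriv_ge h.hasDerivAt_φ h.hasDerivAt_φ₁
    (fun x _ => rpow_nonneg (h.pos x).le p) hpos.le h1 hb ht
  have := mul_nonneg (sq_nonneg a) (h.pos t).le
  linarith

theorem neg_div_le_φ (h : HomoclinicSolution a b p v v₁ φ φ₁) (hb : 0 < b) {R : ℝ}
    (hR : ∀ t, v t ^ p ≤ R) (s : ℝ) : -(R / b ^ 2) ≤ φ s := by
  wlog hs : s = 0 generalizing v v₁ φ φ₁ s
  · simpa using this (h.shift s) (fun t => hR _) 0 rfl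
  subst hs
  by_contra! hneg
  wlog h1 : φ₁ 0 ≤ 0 generalizing v v₁ φ φ₁
  · exact this h.reflect (fun t => hR _) (by simpa) (by simp only [neg_zero]; linarith)
  have hR0 : 0 ≤ R / b ^ 2 := div_nonneg ((rpow_nonneg (h.pos 0).le p).trans (hR 0)) (sq_nonneg b)
  have hδ : 0 < -φ 0 - R / b ^ 2 := by linarith
  refine not_tendsto_of_second_deriv_ge (f := fun t => -v t) (fun t => (h.hasDerivAt_u t).neg)
    (fun t => (h.hasDerivAt_u₁ t).neg) (half_pos hδ) ?_ 0 (by simpa using h.tendsto_atTop.neg)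
  have hsmall : ∀ᶠ t in atTop, a ^ 2 * v t < (-φ 0 - R / b ^ 2) / 2 := by
    have := h.tendsto_atTop.const_mul (a ^ 2)
    rw [mul_zero] at this
    exact this.eventually (gt_mem_nhds (half_pos hδ))
  filter_upwards [eventually_ge_atTop 0, hsmall] with t ht hvt
  have := le_of_second_deriv_ge (b := b) (T := t) (φ := fun t => -φ t - R / b ^ 2)
    (φ₁ := fun t => -φ₁ t) (r := fun t => R - v t ^ p) (fun t => (h.hasDerivAt_φ t).neg.sub_const _)
    (fun t => (h.hasDerivAt_φ₁ t).neg.congr_deriv (by field_simp; ring))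
    (fun x _ => sub_nonneg.2 (hR x)) hδ.le (by linarith) hb.le ht
  linarith

/-- Vanishing of the conserved energy on homoclinic solutions. -/
theorem energy_eq_zero (h : HomoclinicSolution a b p v v₁ φ φ₁) (hb : 0 < b) (hp : 0 < p) (t : ℝ) :
    -(φ₁ t + a ^ 2 * v₁ t) * v₁ t + (φ t + a ^ 2 * v t) ^ 2 / 2 + (a ^ 2 + b ^ 2) / 2 * v₁ t ^ 2
      + v t ^ (p + 1) / (p + 1) - a ^ 2 * b ^ 2 / 2 * v t ^ 2 = 0 := by
  obtain ⟨T, hT⟩ := h.exists_max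
  have hv : ∃ M, ∀ t, |v t| ≤ M := ⟨v T, fun t => by rw [abs_of_pos (h.pos t)]; exact hT t⟩
  have hR : ∀ t, v t ^ p ≤ v T ^ p := fun t => rpow_le_rpow (h.pos t).le (hT t) hp.le
  have hφ : ∃ M, ∀ t, |φ t| ≤ M := ⟨v T ^ p / b ^ 2, fun t => abs_le.2
    ⟨h.neg_div_le_φ hb hR t, (h.φ_nonpos hb.le t).trans
      (div_nonneg (rpow_nonneg (h.pos T).le p) (sq_nonneg b))⟩⟩
  have hφ'' : ∃ M, ∀ t, |b ^ 2 * φ t + v t ^ p| ≤ M := by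
    obtain ⟨M, hM⟩ := hφ
    refine ⟨b ^ 2 * M + v T ^ p, fun t => (abs_add_le _ _).trans ?_⟩
    rw [abs_mul, abs_of_nonneg (sq_nonneg b), abs_of_nonneg (rpow_nonneg (h.pos t).le p)]
    gcongr
    exacts [hM t, (h.pos t).le, hT t]
  obtain ⟨D, hD⟩ := exists_deriv_bound h.hasDerivAt_φ h.hasDerivAt_φ₁ hφ hφ''
  have hv'' : ∃ M, ∀ t, |φ t + a ^ 2 * v t| ≤ M := by
    obtain ⟨M, hM⟩ := hφ
    refine ⟨M + a ^ 2 * v T, fun t => (abs_add_le _ _).trans ?_⟩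
    rw [abs_mul, abs_of_nonneg (sq_nonneg a), abs_of_pos (h.pos t)]
    gcongr
    exacts [hM t, hT t]
  have hdv'' : ∀ t, HasDerivAt (fun t => φ t + a ^ 2 * v t) (φ₁ t + a ^ 2 * v₁ t) t := fun t =>
    (h.hasDerivAt_φ t).add ((h.hasDerivAt_u t).const_mul _)
  have hdv''' : ∀ t, HasDerivAt (fun t => φ₁ t + a ^ 2 * v₁ t)
      (b ^ 2 * φ t + v t ^ p + a ^ 2 * (φ t + a ^ 2 * v t)) t := fun t =>
    (h.hasDerivAt_φ₁ t).add ((h.hasDerivAt_u₁ t).const_mul _)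
  have hv4 : ∃ M, ∀ t, |b ^ 2 * φ t + v t ^ p + a ^ 2 * (φ t + a ^ 2 * v t)| ≤ M := by
    obtain ⟨M, hM⟩ := hφ''
    obtain ⟨N, hN⟩ := hv''
    refine ⟨M + a ^ 2 * N, fun t => (abs_add_le _ _).trans ?_⟩
    rw [abs_mul, abs_of_nonneg (sq_nonneg a)]
    gcongr
    exacts [hM t, hN t]
  obtain ⟨C, hC⟩ := exists_deriv_bound hdv'' hdv''' hv'' hv4
  have hlim₁ : Tendsto v₁ atTop (nhds 0) :=
    tendsto_deriv_zero h.hasDerivAt_u h.hasDerivAt_u₁ h.tendsto_atTop hv''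
  have hlim₂ : Tendsto (fun t => φ t + a ^ 2 * v t) atTop (nhds 0) :=
    tendsto_deriv_zero h.hasDerivAt_u₁ hdv'' hlim₁ ⟨C, hC⟩
  have hlim₃ : Tendsto (fun t => φ₁ t + a ^ 2 * v₁ t) atTop (nhds 0) :=
    tendsto_deriv_zero hdv'' hdv''' hlim₂ hv4
  have hlimp : Tendsto (fun t => v t ^ (p + 1)) atTop (nhds 0) := by
    have := h.tendsto_atTop.rpow_const (p := p + 1) (Or.inr (by linarith))
    rwa [zero_rpow (by linarith)] at this
  set E : ℝ → ℝ := fun t => -(φ₁ t + a ^ 2 * v₁ t) * v₁ t + (φ t + a ^ 2 * v t) ^ 2 / 2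
    + (a ^ 2 + b ^ 2) / 2 * v₁ t ^ 2 + v t ^ (p + 1) / (p + 1)
    - a ^ 2 * b ^ 2 / 2 * v t ^ 2 with hE
  have hlimE : Tendsto E atTop (nhds 0) := by
    have := (((((hlim₃.neg.mul hlim₁).add ((hlim₂.pow 2).div_const 2)).add
      ((hlim₁.pow 2).const_mul ((a ^ 2 + b ^ 2) / 2))).add (hlimp.div_const (p + 1))).sub
      ((h.tendsto_atTop.pow 2).const_mul (a ^ 2 * b ^ 2 / 2)))
    simpa [hE] using this
  have hdE : ∀ t, HasDerivAt E 0 t := by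
    intro t
    have hrpow : HasDerivAt (fun t => v t ^ (p + 1)) (v₁ t * (p + 1) * v t ^ p) t := by
      simpa using (h.hasDerivAt_u t).rpow_const (p := p + 1) (Or.inl (h.pos t).ne')
    refine ((((((hdv''' t).neg.mul (h.hasDerivAt_u₁ t)).add (((hdv'' t).pow 2).div_const 2)).add
      (((h.hasDerivAt_u₁ t).pow 2).const_mul ((a ^ 2 + b ^ 2) / 2))).add
      (hrpow.div_const (p + 1))).sub
      (((h.hasDerivAt_u t).pow 2).const_mul (a ^ 2 * b ^ 2 / 2))).congr_deriv ?_
    have : p + 1 ≠ 0 := by linarith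
    simp only [Pi.neg_apply]
    field_simp
    ring
  have hconst : ∀ s, E s = E t := fun s =>
    is_const_of_deriv_eq_zero (fun x => (hdE x).differentiableAt) (fun x => (hdE x).deriv) s t
  exact tendsto_nhds_unique (tendsto_const_nhds.congr fun s => (hconst s).symm) hlimE

theorem eq_of_eq_data (h : HomoclinicSolution a b p v v₁ φ φ₁)
    (h' : HomoclinicSolution a b p w w₁ ψ ψ₁) (hp : 1 ≤ p) (h0 : v 0 = w 0) (h1 : v₁ 0 = w₁ 0)
    (h2 : φ 0 = ψ 0) (h3 : φ₁ 0 = ψ₁ 0) (t : ℝ) : v t = w t := by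
  obtain ⟨T, hT⟩ := h.exists_max
  obtain ⟨S, hS⟩ := h'.exists_max
  have := (h.toFactoredSystem.sub_smul h'.toFactoredSystem 1).eq_zero
    (L := p * max (v T) (w S) ^ (p - 1)) (fun t => ?_) (by simp [h0]) (by simp [h1]) (by simp [h2])
    (by simp [h3]) t
  · simpa [sub_eq_zero] using this
  · simpa using abs_rpow_sub_rpow_le hp (h.pos t).le ((hT t).trans (le_max_left _ _))
      (h'.pos t).le ((hS t).trans (le_max_right _ _))

theorem φ₁_zero_of_critical (h : HomoclinicSolution a b p v v₁ φ φ₁) (hb : 0 ≤ b) (hp : 0 ≤ p)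
    (h1 : v₁ 0 = 0) : φ₁ 0 = 0 := by
  have key : ∀ {v v₁ φ φ₁ : ℝ → ℝ}, HomoclinicSolution a b p v v₁ φ φ₁ → v₁ 0 = 0 →
      φ₁ 0 ≤ 0 := by
    intro v v₁ φ φ₁ h h1
    by_contra! hpos
    refine (h.toFactoredSystem.sub_smul h.reflect.toFactoredSystem 1).false_of_third_pos hb
      (fun t ht => ?_) ?_ (by simp) (by simp [h1]) (by simp) (by simpa using hpos)
    · simp only [one_mul, sub_nonneg] at ht ⊢
      exact rpow_le_rpow (h.pos _).le ht hp
    · simpa using h.tendsto_atTop.sub (h.reflect.tendsto_atTop)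
  have := key h h1
  have := key h.reflect (by simpa using h1)
  simp only [neg_zero] at this
  linarith

theorem even_of_critical (h : HomoclinicSolution a b p v v₁ φ φ₁) (hb : 0 ≤ b) (hp : 1 ≤ p)
    (h1 : v₁ 0 = 0) (t : ℝ) : v (-t) = v t :=
  h.reflect.eq_of_eq_data h hp (by simp) (by simp [h1]) (by simp)
    (by simp [h.φ₁_zero_of_critical hb (by linarith) h1]) t

theorem le_of_critical (h : HomoclinicSolution a b p v v₁ φ φ₁) (hb : 0 ≤ b) (hp : 1 ≤ p)
    (h1 : v₁ 0 = 0) (t : ℝ) : v t ≤ v 0 := by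
  obtain ⟨T, hT⟩ := h.exists_max
  rcases eq_or_ne T 0 with rfl | hT0
  · exact hT t
  exfalso
  have hT1 : v₁ T = 0 :=
    IsLocalMax.hasDerivAt_eq_zero (Eventually.of_forall hT) (h.hasDerivAt_u T)
  have hper : Function.Periodic v (2 * T) := by
    intro x
    have e1 := (h.shift T).even_of_critical hb hp (by simpa using hT1) (x + T)
    have e2 := h.even_of_critical hb hp h1 x
    simp only [neg_add_rev, neg_add_cancel_comm] at e1
    rw [← e2, show x + 2 * T = x + T + T by ring, ← e1]
  wlog hpos : 0 < T generalizing T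
  · have hneg : T < 0 := lt_of_le_of_ne (not_lt.1 hpos) hT0
    have e := h.even_of_critical hb hp h1 T
    refine this (-T) (fun t => e ▸ hT t) (neg_ne_zero.2 hT0) ?_ ?_ (by linarith)
    · exact IsLocalMax.hasDerivAt_eq_zero (Eventually.of_forall fun t => by
        rw [e]; exact hT t) (h.hasDerivAt_u (-T))
    · simpa using hper.neg
  have hlim : Tendsto (fun n : ℕ => v (n * (2 * T))) atTop (nhds 0) :=
    h.tendsto_atTop.comp
      ((tendsto_natCast_atTop_atTop (R := ℝ)).atTop_mul_const (by linarith))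
  have hc : ∀ n : ℕ, v (n * (2 * T)) = v 0 := fun n => hper.nat_mul_eq n
  simp only [hc] at hlim
  exact (h.pos 0).ne' (tendsto_nhds_unique tendsto_const_nhds hlim)

theorem second_deriv_nonpos_of_critical (h : HomoclinicSolution a b p v v₁ φ φ₁) (hb : 0 ≤ b)
    (hp : 1 ≤ p) (h1 : v₁ 0 = 0) : φ 0 + a ^ 2 * v 0 ≤ 0 := by
  by_contra! hpos
  have := eventually_pos_of_hasDerivAt (f := fun t => v t - v 0)
    (fun t => (h.hasDerivAt_u t).sub_const _) (by simp)
    (eventually_pos_of_hasDerivAt h.hasDerivAt_u₁ h1 (eventually_nhdsGT_pos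
      ((h.hasDerivAt_φ 0).continuousAt.add ((h.hasDerivAt_u 0).continuousAt.const_mul _)) hpos))
  obtain ⟨t, ht⟩ := this.exists
  linarith [h.le_of_critical hb hp h1 t]

/-- Two homoclinic solutions with a critical point at `0` coincide. -/
theorem unique (h : HomoclinicSolution a b p v v₁ φ φ₁)
    (h' : HomoclinicSolution a b p w w₁ ψ ψ₁) (hb : 0 < b) (hp : 1 < p) (h1 : v₁ 0 = 0)
    (h1' : w₁ 0 = 0) (t : ℝ) : v t = w t := by
  wlog hle : w 0 ≤ v 0 generalizing v v₁ φ φ₁ w w₁ ψ ψ₁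
  · exact (this h' h h1' h1 (le_of_not_ge hle)).symm
  have hX := h.second_deriv_nonpos_of_critical hb.le hp.le h1
  have hY := h'.second_deriv_nonpos_of_critical hb.le hp.le h1'
  have hEv := h.energy_eq_zero hb (by linarith) 0
  have hEw := h'.energy_eq_zero hb (by linarith) 0
  simp only [h1, h1', mul_zero, zero_add, ne_eq, OfNat.ofNat_ne_zero, not_false_eq_true, zero_pow,
    add_zero] at hEv hEw
  rcases hle.eq_or_lt with heq | hlt
  · refine h.eq_of_eq_data h' hp.le heq.symm (by rw [h1, h1']) ?_ ?_ t
    · rw [heq] at hEw hY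
      have : (-(φ 0 + a ^ 2 * v 0)) ^ 2 = (-(ψ 0 + a ^ 2 * v 0)) ^ 2 := by linarith
      have := (pow_left_inj₀ (by linarith) (by linarith) two_ne_zero).1 this
      linarith
    · rw [h.φ₁_zero_of_critical hb.le (by linarith) h1,
        h'.φ₁_zero_of_critical hb.le (by linarith) h1']
  exfalso
  have hw0 := h'.pos 0
  obtain ⟨κ, hκ⟩ : ∃ κ, v 0 = κ * w 0 := ⟨v 0 / w 0, by field_simp⟩
  have hκ1 : 1 < κ := by
    by_contra! hcon
    nlinarith
  have hκ0 : 0 < κ := by linarith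
  refine (h.toFactoredSystem.sub_smul h'.toFactoredSystem κ).false_of_second_pos hb.le
    (fun t ht => ?_) ?_ ?_ (by simp [hκ]) (by simp [h1, h1']) ?_
  · rw [sub_nonneg] at ht ⊢
    calc κ * w t ^ p ≤ κ ^ p * w t ^ p := by
          gcongr
          · exact rpow_nonneg (h'.pos t).le p
          · simpa using rpow_le_rpow_of_exponent_le hκ1.le hp.le
      _ = (κ * w t) ^ p := (mul_rpow hκ0.le (h'.pos t).le).symm
      _ ≤ v t ^ p := rpow_le_rpow (mul_pos hκ0 (h'.pos t)).le ht (by linarith)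
  · simpa using h.tendsto_atTop.sub (h'.tendsto_atTop.const_mul κ)
  · simpa using h.tendsto_atBot.sub (h'.tendsto_atBot.const_mul κ)
  · have hpow : κ ^ 2 * w 0 ^ (p + 1) < v 0 ^ (p + 1) := by
      rw [hκ, mul_rpow hκ0.le hw0.le]
      gcongr
      have := rpow_lt_rpow_of_exponent_lt hκ1 (show (2 : ℝ) < p + 1 by linarith)
      rwa [rpow_two] at this
    have hdiv : κ ^ 2 * (w 0 ^ (p + 1) / (p + 1)) < v 0 ^ (p + 1) / (p + 1) := by
      rw [← mul_div_assoc]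
      gcongr
    have hv2 : v 0 ^ 2 = κ ^ 2 * w 0 ^ 2 := by rw [hκ]; ring
    have hsq : (-(φ 0 + a ^ 2 * v 0)) ^ 2 < (-(κ * (ψ 0 + a ^ 2 * w 0))) ^ 2 := by
      have := congrArg (κ ^ 2 * ·) hEw
      simp only [mul_zero] at this
      rw [hv2] at hEv
      linarith
    have := lt_of_pow_lt_pow_left₀ 2 (by nlinarith) hsq
    rw [hκ] at this
    linarith

end HomoclinicSolution

/-- A decaying positive solution of the equation, written as a factored first-order system. -/
theorem homoclinicSolution_of_ode {n : ℕ} {v : ℝ → ℝ} (hreg : ContDiff ℝ 4 v)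
    (hode : ∀ t : ℝ, iteratedDeriv 4 v t - Paper.A n * iteratedDeriv 2 v t
      - Paper.f n (v t) = 0)
    (hpos : ∀ t : ℝ, 0 < v t) (hlim : Tendsto v atTop (nhds 0) ∧ Tendsto v atBot (nhds 0)) :
    HomoclinicSolution (((n : ℝ) - 4) / 2) ((n : ℝ) / 2) (Paper.p n) v (deriv v)
      (fun t => iteratedDeriv 2 v t - (((n : ℝ) - 4) / 2) ^ 2 * v t)
      (fun t => iteratedDeriv 3 v t - (((n : ℝ) - 4) / 2) ^ 2 * deriv v t) := by
  have hd : ∀ k : ℕ, k < 4 → ∀ t, HasDerivAt (iteratedDeriv k v) (iteratedDeriv (k + 1) v t) t := by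
    intro k hk t
    rw [iteratedDeriv_succ]
    exact ((hreg.differentiable_iteratedDeriv k (by exact_mod_cast hk)) t).hasDerivAt
  have hd0 : ∀ t, HasDerivAt v (deriv v t) t := by simpa using hd 0 (by norm_num)
  have hd1 : ∀ t, HasDerivAt (deriv v) (iteratedDeriv 2 v t) t := by
    simpa using hd 1 (by norm_num)
  refine ⟨⟨hd0, fun t => (hd1 t).congr_deriv (by ring), fun t => ?_, fun t => ?_⟩, hpos,
    hlim.1, hlim.2⟩
  · exact (hd 2 (by norm_num) t).sub ((hd0 t).const_mul _)
  · refine ((hd 3 (by norm_num) t).sub ((hd1 t).const_mul _)).congr_deriv ?_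
    have hrpow : |v t| ^ (Paper.p n - 1) * v t = v t ^ Paper.p n := by
      rw [abs_of_pos (hpos t), ← rpow_add_one (hpos t).ne', sub_add_cancel]
    have := hode t
    rw [Paper.f, hrpow, Paper.A, Paper.B] at this
    linear_combination this

/-- **Lemma 8.** Uniqueness of the homoclinic solution: two positive `C⁴` solutions of
`v'''' - A v'' - f(v) = 0` tending to `0` at `±∞` with critical points at `0` coincide. -/
theorem unique_homoclinic (n : ℕ) (hn : 5 ≤ n) (v w : ℝ → ℝ)
    (hvreg : ContDiff ℝ 4 v) (hwreg : ContDiff ℝ 4 w)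
    (hvode : ∀ t : ℝ, iteratedDeriv 4 v t - Paper.A n * iteratedDeriv 2 v t
      - Paper.f n (v t) = 0)
    (hwode : ∀ t : ℝ, iteratedDeriv 4 w t - Paper.A n * iteratedDeriv 2 w t
      - Paper.f n (w t) = 0)
    (hvpos : ∀ t : ℝ, 0 < v t) (hwpos : ∀ t : ℝ, 0 < w t)
    (hvlim : Tendsto v atTop (nhds 0) ∧ Tendsto v atBot (nhds 0))
    (hwlim : Tendsto w atTop (nhds 0) ∧ Tendsto w atBot (nhds 0))
    (hv0 : deriv v 0 = 0) (hw0 : deriv w 0 = 0) :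
    ∀ t : ℝ, v t = w t := by
  have hn' : (5 : ℝ) ≤ n := by exact_mod_cast hn
  have hp : 1 < Paper.p n := by
    rw [Paper.p, one_lt_div (by linarith)]
    linarith
  exact (homoclinicSolution_of_ode hvreg hvode hvpos hvlim).unique
    (homoclinicSolution_of_ode hwreg hwode hwpos hwlim) (by linarith) hp hv0 hw0
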